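/- (Synthesis soundness.) Let L = (V, stem, T, exit) be a polynomial lasso program and let post = {g_1, …, g_m} be a finite set of post-condition polynomials in MvPolynomial (Fin n) ℝ. Let p, s ∈ MvPolynomial (Fin n) ℝ, d ∈ ℕ, and for each τ ∈ T let q_τ, Φ_τ ∈ MvPolynomial (Fin n) ℝ, and for each i let Ω_i ∈ MvPolynomial (Fin n) ℝ. Assume: (i) p ∈ ⟨stem⟩; (ii) for each τ ∈ T, rename Sum.inl (q_τ^d · s) · rename Sum.inr p − rename Sum.inl (Φ_τ · p) ∈ ⟨τ⟩; (iii) for every valuation not satisfying exit, q_τ (for each τ) and s evaluate to nonzero values; (iv) for each i, g_i − Ω_i · p ∈ ⟨exit⟩. Then L is partially correct with respect to post: for every finite execution ν_0 … ν_k of L, every post polynomial g_i evaluates to 0 at the last valuation ν_k; moreover p is an inductive invariant of L. -/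

import Mathlib

open MvPolynomial

/-- A polynomial in the ideal spanned by `S` vanishes at every common zero of `S`. -/
theorem eval_eq_zero_of_mem_span {σ R : Type*} [CommSemiring R] {S : Set (MvPolynomial σ R)}
    {x : σ → R} {f : MvPolynomial σ R} (hf : f ∈ Ideal.span S)
    (hx : ∀ r ∈ S, eval x r = 0) : eval x f = 0 := by
  have h : Ideal.span S ≤ RingHom.ker (eval x) := Ideal.span_le.2 hx
  exact h hf

theorem synthesis_soundness (n m : ℕ)
    (stem exitA : Set (MvPolynomial (Fin n) ℝ))
    (T : Set (Set (MvPolynomial (Fin n ⊕ Fin n) ℝ))) (hT : T.Finite)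
    (g : Fin m → MvPolynomial (Fin n) ℝ)
    (p s : MvPolynomial (Fin n) ℝ) (d : ℕ)
    (q Φ : Set (MvPolynomial (Fin n ⊕ Fin n) ℝ) → MvPolynomial (Fin n) ℝ)
    (Ω : Fin m → MvPolynomial (Fin n) ℝ)
    (h1 : p ∈ Ideal.span stem)
    (h2 : ∀ τ ∈ T,
      rename Sum.inl ((q τ) ^ d * s) * rename Sum.inr p
        - rename Sum.inl (Φ τ * p) ∈ Ideal.span τ)
    (h3 : ∀ ν : Fin n → ℝ, ¬ (∀ r ∈ exitA, eval ν r = 0) →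
      (∀ τ ∈ T, eval ν (q τ) ≠ 0) ∧ eval ν s ≠ 0)
    (h4 : ∀ i : Fin m, g i - Ω i * p ∈ Ideal.span exitA) :
    (∀ (k : ℕ) (ν : Fin (k + 1) → Fin n → ℝ),
      (∀ r ∈ stem, eval (ν 0) r = 0) →
      (∀ i : Fin k, ∃ τ ∈ T,
        ∀ r ∈ τ, eval (Sum.elim (ν i.castSucc) (ν i.succ)) r = 0) →
      (∀ i : Fin (k + 1), (∀ r ∈ exitA, eval (ν i) r = 0) ↔ i = Fin.last k) →
      ∀ i : Fin m, eval (ν (Fin.last k)) (g i) = 0) ∧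
    ((∀ ν : Fin n → ℝ, (∀ r ∈ stem, eval ν r = 0) → eval ν p = 0) ∧
     (∀ τ ∈ T, ∀ ν ν' : Fin n → ℝ, eval ν p = 0 →
        (∀ r ∈ τ, eval (Sum.elim ν ν') r = 0) →
        ¬ (∀ r ∈ exitA, eval ν r = 0) → eval ν' p = 0)) := by
  have init : ∀ ν : Fin n → ℝ, (∀ r ∈ stem, eval ν r = 0) → eval ν p = 0 :=
    fun ν hν => eval_eq_zero_of_mem_span h1 hν
  have step : ∀ τ ∈ T, ∀ ν ν' : Fin n → ℝ, eval ν p = 0 →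
      (∀ r ∈ τ, eval (Sum.elim ν ν') r = 0) →
      ¬ (∀ r ∈ exitA, eval ν r = 0) → eval ν' p = 0 := by
    intro τ hτ ν ν' hp hr he
    have h := eval_eq_zero_of_mem_span (h2 τ hτ) hr
    obtain ⟨hq, hs⟩ := h3 ν he
    simpa [eval_rename, hp, hq τ hτ, hs] using h
  refine ⟨fun k ν hstem htrans hexit i => ?_, init, step⟩
  have inv : ∀ j : Fin (k + 1), eval (ν j) p = 0 := by
    intro j
    induction j using Fin.induction with
    | zero => exact init _ hstem
    | succ j ih =>
      obtain ⟨τ, hτ, hr⟩ := htrans j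
      exact step τ hτ _ _ ih hr fun h => (Fin.castSucc_lt_last j).ne ((hexit _).1 h)
  have h := eval_eq_zero_of_mem_span (h4 i) ((hexit (Fin.last k)).2 rfl)
  simpa [inv (Fin.last k)] using h
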